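/- arXiv:2306.09009 — 2 statements merged into one kernel-verified Lean document; each statement's English description precedes it below -/
import Mathlib

section
/- Let p ≥ 3 and A > 0 be real numbers, and let T : [0,∞) → (0,∞) be a differentiable function satisfying the differential inequality T'(t) ≤ −(p−2)·T(t) + (p−1)·T(t)^{(p−3)/(p−1)}·(e^t A)^{2/(p−1)} for all t ≥ 0. Then for all t ≥ 0, (e^{(p−2)t} A^{p−2} T(t))^{2/(p−1)} − e^{2t} A² ≤ (A^{p−2} T(0))^{2/(p−1)} − A². -/
open Real Set

lemma rpow_weight_identity {p B x : ℝ} (hp : 1 < p) (hB : 0 < B) (hx : 0 < x) :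
    2 / (p - 1) * (B ^ (p - 2) * x) ^ (2 / (p - 1) - 1) *
      (B ^ (p - 2) * ((p - 1) * x ^ ((p - 3) / (p - 1)) * B ^ (2 / (p - 1)))) = 2 * B ^ 2 := by
  have hp1 : p - 1 ≠ 0 := by linarith
  have hxpow : x ^ (2 / (p - 1) - 1) * x ^ ((p - 3) / (p - 1)) = 1 := by
    have hsum : 2 / (p - 1) - 1 + (p - 3) / (p - 1) = 0 := by
      field_simp
      ring
    rw [← rpow_add hx, hsum, rpow_zero]
  have hBpow : B ^ ((p - 2) * (2 / (p - 1) - 1)) * B ^ (p - 2) * B ^ (2 / (p - 1)) = B ^ 2 := by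
    rw [← rpow_add hB, ← rpow_add hB, ← rpow_natCast]
    congr 1
    push_cast
    field_simp
    ring
  rw [mul_rpow (rpow_nonneg hB.le _) hx.le, ← rpow_mul hB.le]
  calc
    _ = 2 / (p - 1) * (p - 1) * (x ^ (2 / (p - 1) - 1) * x ^ ((p - 3) / (p - 1))) *
        (B ^ ((p - 2) * (2 / (p - 1) - 1)) * B ^ (p - 2) * B ^ (2 / (p - 1))) := by ring
    _ = _ := by rw [hxpow, hBpow, div_mul_cancel₀ _ hp1, mul_one]

theorem stmt_2 (p A : ℝ) (hp : 3 ≤ p) (hA : 0 < A) (T T' : ℝ → ℝ)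
    (hTpos : ∀ t ≥ (0 : ℝ), 0 < T t)
    (hTderiv : ∀ t ≥ (0 : ℝ), HasDerivWithinAt T (T' t) (Ici 0) t)
    (hineq : ∀ t ≥ (0 : ℝ),
      T' t ≤ -(p - 2) * T t + (p - 1) * (T t) ^ ((p - 3) / (p - 1)) *
        (Real.exp t * A) ^ (2 / (p - 1))) :
    ∀ t ≥ (0 : ℝ),
      (Real.exp ((p - 2) * t) * A ^ (p - 2) * T t) ^ (2 / (p - 1)) -
          Real.exp (2 * t) * A ^ 2
        ≤ (A ^ (p - 2) * T 0) ^ (2 / (p - 1)) - A ^ 2 := by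
  have hweight (t : ℝ) : Real.exp ((p - 2) * t) * A ^ (p - 2) = (Real.exp t * A) ^ (p - 2) := by
    rw [mul_rpow (Real.exp_pos t).le hA.le, ← Real.exp_mul, mul_comm t]
  have hexp (t : ℝ) : Real.exp (2 * t) * A ^ 2 = (Real.exp t * A) ^ 2 := by
    rw [mul_pow, ← Real.exp_nat_mul]
    norm_num
  have hderiv : ∀ t ≥ (0 : ℝ), HasDerivWithinAt
      (fun t ↦ (Real.exp ((p - 2) * t) * A ^ (p - 2) * T t) ^ (2 / (p - 1)) -
        Real.exp (2 * t) * A ^ 2)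
      (2 / (p - 1) * (Real.exp ((p - 2) * t) * A ^ (p - 2) * T t) ^ (2 / (p - 1) - 1) *
          (Real.exp ((p - 2) * t) * A ^ (p - 2) * (T' t + (p - 2) * T t)) -
        2 * (Real.exp (2 * t) * A ^ 2)) (Ici 0) t := by
    intro t ht
    have hlin (c : ℝ) : HasDerivWithinAt (fun t ↦ Real.exp (c * t)) (Real.exp (c * t) * (c * 1))
        (Ici 0) t := ((hasDerivAt_id t).const_mul c).exp.hasDerivWithinAt
    have hpos : 0 < Real.exp ((p - 2) * t) * A ^ (p - 2) * T t := by
      have := hTpos t ht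
      positivity
    have h := ((((hlin (p - 2)).mul_const (A ^ (p - 2))).mul (hTderiv t ht)).rpow_const
      (p := 2 / (p - 1)) (Or.inl hpos.ne')).sub ((hlin 2).mul_const (A ^ 2))
    refine h.congr_deriv ?_
    simp only [Pi.mul_apply]
    ring
  have hanti := antitoneOn_of_hasDerivWithinAt_nonpos (convex_Ici (0 : ℝ))
    (fun t ht ↦ (hderiv t ht).continuousWithinAt)
    (fun t ht ↦ (hderiv t (interior_subset ht)).mono interior_subset) (by
      intro t ht
      have ht0 : 0 ≤ t := interior_subset ht
      have hT := hTpos t ht0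
      have hB : 0 < Real.exp t * A := by positivity
      rw [hweight, hexp, sub_nonpos,
        ← rpow_weight_identity (show 1 < p by linarith) hB hT]
      have hq : 0 ≤ 2 / (p - 1) := div_nonneg zero_le_two (by linarith)
      gcongr
      linarith [hineq t ht0])
  intro t ht
  simpa using hanti self_mem_Ici ht ht
end

section
/- For every real number s > 0, one has √s / arsinh(√s) < (1/2)(1 + √(1 + s)). -/
open Real

theorem sinh_lt_mul_cosh {u : ℝ} (hu : 0 < u) : sinh u < u * cosh u := by
  have hderiv (x : ℝ) : HasDerivAt (fun x => x * cosh x - sinh x) (x * sinh x) x := by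
    refine (((hasDerivAt_id' x).mul (hasDerivAt_cosh x)).sub (hasDerivAt_sinh x)).congr_deriv ?_
    ring
  have hmono : StrictMonoOn (fun x => x * cosh x - sinh x) (Set.Ici 0) := by
    refine strictMonoOn_of_deriv_pos (convex_Ici 0)
      (fun x _ => (hderiv x).continuousAt.continuousWithinAt) fun x hx => ?_
    rw [interior_Ici, Set.mem_Ioi] at hx
    rw [(hderiv x).deriv]
    exact mul_pos hx (sinh_pos_iff.2 hx)
  simpa using hmono Set.self_mem_Ici hu.le hu

theorem two_mul_sinh_lt_mul_one_add_cosh {t : ℝ} (ht : 0 < t) :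
    2 * sinh t < t * (1 + cosh t) := by
  obtain ⟨u, rfl⟩ : ∃ u, t = 2 * u := ⟨t / 2, by ring⟩
  have hlt := mul_lt_mul_of_pos_right (sinh_lt_mul_cosh (u := u) (by linarith)) (cosh_pos u)
  rw [sinh_two_mul, cosh_two_mul, sinh_sq]
  linarith

theorem stmt_12 (s : ℝ) (hs : 0 < s) :
    Real.sqrt s / Real.arsinh (Real.sqrt s) < (1 / 2) * (1 + Real.sqrt (1 + s)) := by
  have hpos : 0 < arsinh √s := arsinh_pos_iff.2 (sqrt_pos.2 hs)
  have hlt := two_mul_sinh_lt_mul_one_add_cosh hpos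
  rw [sinh_arsinh, cosh_arsinh, sq_sqrt hs.le] at hlt
  rw [div_lt_iff₀ hpos]
  linarith
end
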